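/- Let β ∈ 𝒜 and suppose the set Λ_X(𝒜,β) of normalized X-circuits of 𝒜 lying in N_β is nonempty. Then the X-AGE cone equals the convex hull of the union of the λ-witnessed AGE cones: C_X(𝒜,β) = conv( ∪_{λ ∈ Λ_X(𝒜,β)} C_X(𝒜,λ) ). -/

import Mathlib

open Finset

/-- Dot product on `Fin n → ℝ`. -/
noncomputable def dotp {n : ℕ} (y x : Fin n → ℝ) : ℝ := ∑ i, y i * x i

/-- Support function `σ_X : ℝⁿ → ℝ ∪ {±∞}` of a set `X ⊆ ℝⁿ`. -/
noncomputable def suppFn {n : ℕ} (X : Set (Fin n → ℝ)) (y : Fin n → ℝ) : EReal :=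
  ⨆ x ∈ X, ((dotp y x : ℝ) : EReal)

/-- The linear map `𝒜 : ℝ^𝒜 → ℝⁿ`, `ν ↦ Σ_α ν_α α`. -/
noncomputable def Amap {n m : ℕ} (A : Fin m → Fin n → ℝ) (ν : Fin m → ℝ) : Fin n → ℝ :=
  fun j => ∑ i, ν i * A i j

/-- `N_β = {ν : ν_α ≥ 0 (α ≠ β), Σ ν_α = 0}`. -/
def Nbeta {m : ℕ} (b : Fin m) : Set (Fin m → ℝ) :=
  {ν | (∀ i, i ≠ b → 0 ≤ ν i) ∧ ∑ i, ν i = 0}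

/-- Two vectors are proportional if one is a scalar multiple of the other. -/
def Proportional {m : ℕ} (u v : Fin m → ℝ) : Prop :=
  ∃ t : ℝ, u = t • v ∨ v = t • u

/-- The augmented support function `ν ↦ σ_X(-𝒜ν)`. -/
noncomputable def sigA {n m : ℕ} (X : Set (Fin n → ℝ)) (A : Fin m → Fin n → ℝ)
    (ν : Fin m → ℝ) : EReal :=
  suppFn X (-(Amap A ν))

/-- The map `ν ↦ σ_X(-𝒜ν)` is affine on the segment `[ν1, ν2]`. -/
def SigmaAffineOnSeg {n m : ℕ} (X : Set (Fin n → ℝ)) (A : Fin m → Fin n → ℝ)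
    (ν1 ν2 : Fin m → ℝ) : Prop :=
  ∀ t : ℝ, t ∈ Set.Icc (0:ℝ) 1 →
    sigA X A (t • ν1 + (1 - t) • ν2) =
      (t : EReal) * sigA X A ν1 + ((1 - t : ℝ) : EReal) * sigA X A ν2

/-- `ν` is an `X`-circuit of `𝒜` (with negative index allowed only at `b`). -/
def IsXCircuit {n m : ℕ} (X : Set (Fin n → ℝ)) (A : Fin m → Fin n → ℝ)
    (b : Fin m) (ν : Fin m → ℝ) : Prop :=
  ν ∈ Nbeta b ∧ ν ≠ 0 ∧ sigA X A ν < ⊤ ∧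
  ¬ ∃ (ν1 ν2 : Fin m → ℝ) (θ : ℝ), ν1 ∈ Nbeta b ∧ ν2 ∈ Nbeta b ∧
      ¬ Proportional ν1 ν2 ∧ θ ∈ Set.Ioo (0:ℝ) 1 ∧
      ν = θ • ν1 + (1 - θ) • ν2 ∧ SigmaAffineOnSeg X A ν1 ν2

/-- All finite nonnegative combinations of elements of `S` (including `0`). -/
def coneHull {E : Type*} [AddCommMonoid E] [SMul ℝ E] (S : Set E) : Set E :=
  {x | ∃ (k : ℕ) (t : Fin k → ℝ) (v : Fin k → E),
    (∀ j, 0 ≤ t j) ∧ (∀ j, v j ∈ S) ∧ x = ∑ j, t j • v j}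

/-- `v` is an edge generator of the convex cone `K`. -/
def IsEdgeGenerator {E : Type*} [AddCommMonoid E] [SMul ℝ E] (K : Set E) (v : E) : Prop :=
  v ≠ 0 ∧ v ∈ K ∧ ∀ u ∈ K, ∀ w ∈ K, v = u + w →
    (∃ a : ℝ, 0 ≤ a ∧ u = a • v) ∧ (∃ b : ℝ, 0 ≤ b ∧ w = b • v)

/-- The `X`-AGE cone `C_X(𝒜, β)`, as a cone of coefficient vectors. -/
def AgeCone {n m : ℕ} (X : Set (Fin n → ℝ)) (A : Fin m → Fin n → ℝ) (b : Fin m) :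
    Set (Fin m → ℝ) :=
  {c | (∀ i, i ≠ b → 0 ≤ c i) ∧ ∀ x ∈ X, 0 ≤ ∑ i, c i * Real.exp (dotp (A i) x)}

/-- The `X`-SAGE cone `C_X(𝒜) = Σ_β C_X(𝒜, β)`. -/
def Sage {n m : ℕ} (X : Set (Fin n → ℝ)) (A : Fin m → Fin n → ℝ) : Set (Fin m → ℝ) :=
  {c | ∃ f : Fin m → (Fin m → ℝ), (∀ b, f b ∈ AgeCone X A b) ∧ c = ∑ b, f b}

/-- One summand of the relative entropy, with the conventions `0·log 0 = 0` and
`D = ∞` if `a > 0` while `c ≤ 0`. -/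
noncomputable def relEnt (a c : ℝ) : EReal :=
  if a = 0 then 0 else if 0 < c then ((a * Real.log (a / c) : ℝ) : EReal) else ⊤

/-- The relative entropy `D(ν_{∖β}, e · c_{∖β})`. -/
noncomputable def relEntSum {m : ℕ} (b : Fin m) (ν c : Fin m → ℝ) : EReal :=
  ∑ i ∈ Finset.univ.erase b, relEnt (ν i) (Real.exp 1 * c i)

/-- Condition (★): `ν ∈ N_β`, `ν ≠ 0`, `σ_X(-𝒜ν) + D(ν_{∖β}, e c_{∖β}) ≤ c_β`. -/
def StarCond {n m : ℕ} (X : Set (Fin n → ℝ)) (A : Fin m → Fin n → ℝ)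
    (b : Fin m) (c ν : Fin m → ℝ) : Prop :=
  ν ∈ Nbeta b ∧ ν ≠ 0 ∧ sigA X A ν + relEntSum b ν c ≤ (c b : EReal)

/-- The `λ`-witnessed AGE cone `C_X(𝒜, λ)` for a normalized `λ` with `λ_β = -1`. -/
noncomputable def WitnessCone {n m : ℕ} (X : Set (Fin n → ℝ)) (A : Fin m → Fin n → ℝ)
    (b : Fin m) (l : Fin m → ℝ) : Set (Fin m → ℝ) :=
  {c | (∀ i, i ≠ b → 0 ≤ c i) ∧
    (-(c b)) * Real.exp ((sigA X A l).toReal) ≤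
      ∏ i ∈ Finset.univ.filter (fun i => 0 < l i), (c i / l i) ^ (l i)}

/-- Normalized `X`-circuits in `N_β`. -/
def LambdaB {n m : ℕ} (X : Set (Fin n → ℝ)) (A : Fin m → Fin n → ℝ) (b : Fin m) :
    Set (Fin m → ℝ) :=
  {l | IsXCircuit X A b l ∧ l b = -1}

/-- All normalized `X`-circuits of `𝒜`. -/
def Lambda {n m : ℕ} (X : Set (Fin n → ℝ)) (A : Fin m → Fin n → ℝ) : Set (Fin m → ℝ) :=
  ⋃ b, LambdaB X A b

/-- Functional form `φ_λ = (λ, σ_X(-𝒜λ)) ∈ ℝ^𝒜 × ℝ`. -/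
noncomputable def phiVec {n m : ℕ} (X : Set (Fin n → ℝ)) (A : Fin m → Fin n → ℝ)
    (l : Fin m → ℝ) : (Fin m → ℝ) × ℝ :=
  (l, (sigA X A l).toReal)

/-- Functional form as an affine function `φ_λ(y) = Σ y_α λ_α + σ_X(-𝒜λ)`. -/
noncomputable def phiFun {n m : ℕ} (X : Set (Fin n → ℝ)) (A : Fin m → Fin n → ℝ)
    (l : Fin m → ℝ) (y : Fin m → ℝ) : ℝ :=
  (∑ i, y i * l i) + (sigA X A l).toReal

/-- The circuit graph `G_X(𝒜)`. -/
noncomputable def circuitGraph {n m : ℕ} (X : Set (Fin n → ℝ)) (A : Fin m → Fin n → ℝ) :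
    Set ((Fin m → ℝ) × ℝ) :=
  coneHull ((phiVec X A '' Lambda X A) ∪ {((0 : Fin m → ℝ), (1 : ℝ))})

/-- The reduced normalized `X`-circuits `Λ*_X(𝒜)`. -/
noncomputable def LambdaStar {n m : ℕ} (X : Set (Fin n → ℝ)) (A : Fin m → Fin n → ℝ) :
    Set (Fin m → ℝ) :=
  {l | l ∈ Lambda X A ∧ IsEdgeGenerator (circuitGraph X A) (phiVec X A l)}

/-- `λ`-witnessed AGE cone for a normalized circuit, with `β` recovered from `λ`. -/
noncomputable def WitnessConeL {n m : ℕ} (X : Set (Fin n → ℝ)) (A : Fin m → Fin n → ℝ)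
    (l : Fin m → ℝ) : Set (Fin m → ℝ) :=
  ⋃ b ∈ {b : Fin m | l b = -1}, WitnessCone X A b l

/-- Dual cone of a set of coefficient vectors in `ℝ^𝒜`. -/
def dualConeV {m : ℕ} (K : Set (Fin m → ℝ)) : Set (Fin m → ℝ) :=
  {v | ∀ c ∈ K, 0 ≤ ∑ i, v i * c i}

/-- Dual cone of a subset of `ℝ^𝒜 × ℝ`. -/
def dualConeP {m : ℕ} (K : Set ((Fin m → ℝ) × ℝ)) : Set ((Fin m → ℝ) × ℝ) :=
  {p | ∀ q ∈ K, 0 ≤ (∑ i, p.1 i * q.1 i) + p.2 * q.2}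

/-- The basis functions `x ↦ exp(αᵀx)`, `α ∈ 𝒜`, are linearly independent on `X`. -/
def ExpLinIndep {n m : ℕ} (X : Set (Fin n → ℝ)) (A : Fin m → Fin n → ℝ) : Prop :=
  LinearIndependent ℝ (fun i : Fin m => fun x : X => Real.exp (dotp (A i) (x : Fin n → ℝ)))

/-- `X` is a polyhedron: an intersection of finitely many closed halfspaces. -/
def IsPolyhedron {n : ℕ} (X : Set (Fin n → ℝ)) : Prop :=
  ∃ (k : ℕ) (a : Fin k → Fin n → ℝ) (bb : Fin k → ℝ),
    X = {x | ∀ i, dotp (a i) x ≤ bb i}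

/-- Minkowski sum `Σ_{l ∈ Λ} C(l)` (finite sums, one summand per `l`;
the empty sum gives `{0}`). -/
def MinkSumOver {m : ℕ} (Λ : Set (Fin m → ℝ)) (C : (Fin m → ℝ) → Set (Fin m → ℝ)) :
    Set (Fin m → ℝ) :=
  {c | ∃ (s : Finset (Fin m → ℝ)) (f : (Fin m → ℝ) → (Fin m → ℝ)),
    (↑s ⊆ Λ) ∧ (∀ l ∈ s, f l ∈ C l) ∧ c = ∑ l ∈ s, f l}

theorem exists_dual_le_of_mem_closure_of_notMem {E : Type*} [NormedAddCommGroup E]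
    [NormedSpace ℝ E] [FiniteDimensional ℝ E] {C : Set E} (hC : Convex ℝ C) {x : E}
    (hx : x ∈ closure C) (hxC : x ∉ C) :
    ∃ f : StrongDual ℝ E, f ≠ 0 ∧ ∀ y ∈ closure C, f y ≤ f x := by
  suffices h : ∃ f : StrongDual ℝ E, f ≠ 0 ∧ ∀ y ∈ C, f y ≤ f x by
    obtain ⟨f, hf, hle⟩ := h
    exact ⟨f, hf, fun y hy =>
      closure_minimal hle (isClosed_le f.continuous continuous_const) hy⟩
  rcases (interior C).eq_empty_or_nonempty with hint | hint
  · have hne : C.Nonempty := closure_nonempty_iff.1 ⟨x, hx⟩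
    obtain ⟨a, ha⟩ := hne
    have hspan : vectorSpan ℝ C < ⊤ := by
      refine lt_top_iff_ne_top.2 fun h => ?_
      rw [← AffineSubspace.affineSpan_eq_top_iff_vectorSpan_eq_top_of_nonempty ℝ E E ⟨a, ha⟩,
        ← hC.interior_nonempty_iff_affineSpan_eq_top, hint] at h
      exact Set.not_nonempty_empty h
    obtain ⟨f, hf, hker⟩ := Submodule.exists_le_ker_of_lt_top _ hspan
    have hconst : ∀ y ∈ C, f y = f a := fun y hy => by
      have := hker (vsub_mem_vectorSpan ℝ hy ha)
      rw [LinearMap.mem_ker, vsub_eq_sub, map_sub, sub_eq_zero] at this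
      exact this
    have hcont : Continuous f := f.continuous_of_finiteDimensional
    have hxa : f x = f a :=
      closure_minimal (t := {y | f y = f a}) hconst (isClosed_eq hcont continuous_const) hx
    refine ⟨LinearMap.toContinuousLinearMap f, by simpa using hf, fun y hy => ?_⟩
    simp [hconst y hy, hxa]
  · exact geometric_hahn_banach_of_nonempty_interior_point hC
      (fun h => hxC (interior_subset h)) hint

theorem subset_convexHull_extremePoints_of_finrank_eq (d : ℕ) :
    ∀ (E : Type*) [NormedAddCommGroup E] [NormedSpace ℝ E] [FiniteDimensional ℝ E],
      Module.finrank ℝ E = d → ∀ s : Set E, IsCompact s → Convex ℝ s →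
        s ⊆ convexHull ℝ (s.extremePoints ℝ) := by
  induction d using Nat.strong_induction_on with
  | _ d ih =>
    intro E _ _ _ hd s hs hconv x hx
    by_contra hxC
    have hcl := closure_convexHull_extremePoints hs hconv
    obtain ⟨f, hf, hle⟩ := exists_dual_le_of_mem_closure_of_notMem (convex_convexHull ℝ _)
      (hcl.symm ▸ hx) hxC
    rw [hcl] at hle
    let K : Submodule ℝ E := LinearMap.ker f.toLinearMap
    let g : K →ᵃ[ℝ] E := AffineMap.const ℝ K x + K.subtype.toAffineMap
    have hg : ∀ v, g v = x + v := fun v => rfl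
    have hfin : Module.finrank ℝ K < d := by
      rw [← hd]
      refine Submodule.finrank_lt fun h => hf ?_
      ext y
      have : y ∈ K := h ▸ Submodule.mem_top
      simpa [K] using this
    have hclosed : Topology.IsClosedEmbedding g :=
      (Homeomorph.addLeft x).isClosedEmbedding.comp
        K.closed_of_finiteDimensional.isClosedEmbedding_subtypeVal
    have h0 : (0 : K) ∈ convexHull ℝ ((g ⁻¹' s).extremePoints ℝ) :=
      ih _ hfin K rfl _ (hclosed.isCompact_preimage hs) (hconv.affine_preimage g)
        (by simpa [hg] using hx)
    have h1 : x ∈ g '' convexHull ℝ ((g ⁻¹' s).extremePoints ℝ) := ⟨0, h0, by simp [hg]⟩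
    rw [AffineMap.image_convexHull] at h1
    refine hxC (convexHull_mono ?_ h1)
    rintro _ ⟨v, hv, rfl⟩
    rw [mem_extremePoints_iff_left] at hv ⊢
    refine ⟨hv.1, fun y hy z hz hyz => ?_⟩
    obtain ⟨p, q, hp, hq, hpq, hsum⟩ := hyz
    have hfv : f (g v) = f x := by
      have : f (v : E) = 0 := v.2
      simp [hg, this]
    have hfpq : p * f y + q * f z = f x := by
      rw [← hfv, ← hsum]; simp
    have hfy := hle y hy
    have hfz := hle z hz
    have hx1 : f x = p * f x + q * f x := by rw [← add_mul, hpq, one_mul]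
    have ey : f y = f x := by nlinarith
    have ez : f z = f x := by nlinarith
    have hyK : y - x ∈ K := by simp [K, ey]
    have hzK : z - x ∈ K := by simp [K, ez]
    have hgy : g ⟨y - x, hyK⟩ = y := by simp [hg]
    have hgz : g ⟨z - x, hzK⟩ = z := by simp [hg]
    have := hv.2 ⟨y - x, hyK⟩ (by simpa [hgy] using hy) ⟨z - x, hzK⟩ (by simpa [hgz] using hz)
      ⟨p, q, hp, hq, hpq, hclosed.injective (by
        rw [Convex.combo_affine_apply hpq, hgy, hgz, hsum])⟩
    rw [← this, hgy]

/-- **Minkowski's theorem**: a compact convex set in a finite-dimensional space is the convex hull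
of its extreme points. -/
theorem IsCompact.subset_convexHull_extremePoints {E : Type*} [NormedAddCommGroup E]
    [NormedSpace ℝ E] [FiniteDimensional ℝ E] {s : Set E} (hs : IsCompact s) (hconv : Convex ℝ s) :
    s ⊆ convexHull ℝ (s.extremePoints ℝ) :=
  subset_convexHull_extremePoints_of_finrank_eq _ E rfl s hs hconv

theorem dotp_neg_Amap {n m : ℕ} (A : Fin m → Fin n → ℝ) (ν : Fin m → ℝ) (x : Fin n → ℝ) :
    dotp (-(Amap A ν)) x = -∑ i, ν i * dotp (A i) x := by
  simp only [dotp, Amap, Pi.neg_apply, neg_mul, Finset.sum_neg_distrib, Finset.sum_mul,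
    Finset.mul_sum, mul_assoc]
  rw [Finset.sum_comm]

theorem sigA_le_coe_iff {n m : ℕ} {X : Set (Fin n → ℝ)} {A : Fin m → Fin n → ℝ}
    {ν : Fin m → ℝ} {τ : ℝ} :
    sigA X A ν ≤ (τ : EReal) ↔ ∀ x ∈ X, -∑ i, ν i * dotp (A i) x ≤ τ := by
  simp only [sigA, suppFn, iSup_le_iff, dotp_neg_Amap, EReal.coe_le_coe_iff]

theorem sigA_ne_bot {n m : ℕ} {X : Set (Fin n → ℝ)} (hX : X.Nonempty) (A : Fin m → Fin n → ℝ)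
    (ν : Fin m → ℝ) : sigA X A ν ≠ ⊥ := by
  obtain ⟨x, hx⟩ := hX
  intro h
  have h1 := sigA_le_coe_iff.1 (h.le.trans (bot_le
    (a := ((-(∑ i, ν i * dotp (A i) x) - 1 : ℝ) : EReal))))
    x hx
  linarith

/-- The epigraph of `ν ↦ σ_X(-𝒜ν)` over `N_β`. -/
def sigmaEpigraph {n m : ℕ} (X : Set (Fin n → ℝ)) (A : Fin m → Fin n → ℝ) (b : Fin m) :
    Set ((Fin m → ℝ) × ℝ) :=
  {p | p.1 ∈ Nbeta b ∧ ∀ x ∈ X, -∑ i, p.1 i * dotp (A i) x ≤ p.2}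

section Nbeta

variable {m : ℕ} {b : Fin m} {ν μ : Fin m → ℝ}

theorem add_mem_Nbeta (hν : ν ∈ Nbeta b) (hμ : μ ∈ Nbeta b) : ν + μ ∈ Nbeta b :=
  ⟨fun i hi => add_nonneg (hν.1 i hi) (hμ.1 i hi), by
    simp [Finset.sum_add_distrib, hν.2, hμ.2]⟩

theorem smul_mem_Nbeta (hν : ν ∈ Nbeta b) {a : ℝ} (ha : 0 ≤ a) : a • ν ∈ Nbeta b :=
  ⟨fun i hi => mul_nonneg ha (hν.1 i hi), by simp [← Finset.mul_sum, hν.2]⟩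

theorem sum_erase_of_mem_Nbeta (hν : ν ∈ Nbeta b) : ∑ i ∈ univ.erase b, ν i = -ν b := by
  have := Finset.add_sum_erase univ ν (mem_univ b)
  rw [hν.2] at this
  linarith

theorem le_neg_of_mem_Nbeta (hν : ν ∈ Nbeta b) {i : Fin m} (hi : i ≠ b) : ν i ≤ -ν b := by
  rw [← sum_erase_of_mem_Nbeta hν]
  exact Finset.single_le_sum (f := ν) (fun j hj => hν.1 j (Finset.ne_of_mem_erase hj))
    (Finset.mem_erase.2 ⟨hi, mem_univ i⟩)

theorem nonpos_of_mem_Nbeta (hν : ν ∈ Nbeta b) : ν b ≤ 0 := by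
  rw [← neg_nonneg, ← sum_erase_of_mem_Nbeta hν]
  exact Finset.sum_nonneg fun j hj => hν.1 j (Finset.ne_of_mem_erase hj)

theorem eq_zero_of_mem_Nbeta (hν : ν ∈ Nbeta b) (h : ν b = 0) : ν = 0 := by
  ext i
  by_cases hi : i = b
  · simp [hi, h]
  · have h1 := le_neg_of_mem_Nbeta hν hi
    rw [h, neg_zero] at h1
    exact le_antisymm h1 (hν.1 i hi)

theorem sum_filter_pos_of_mem_Nbeta (hν : ν ∈ Nbeta b) (f : Fin m → ℝ) :
    ∑ i ∈ univ.filter (fun i => 0 < ν i), ν i * f i = ∑ i ∈ univ.erase b, ν i * f i := by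
  refine Finset.sum_subset (fun i hi => ?_) fun i hi hi' => ?_
  · refine Finset.mem_erase.2 ⟨?_, mem_univ i⟩
    rintro rfl
    exact absurd (Finset.mem_filter.1 hi).2 (not_lt.2 (nonpos_of_mem_Nbeta hν))
  · have h0 := hν.1 i (Finset.ne_of_mem_erase hi)
    have h1 : ¬ 0 < ν i := fun h => hi' (Finset.mem_filter.2 ⟨mem_univ i, h⟩)
    rw [le_antisymm (not_lt.1 h1) h0, zero_mul]

theorem sum_filter_pos_one_of_mem_Nbeta (hν : ν ∈ Nbeta b) :
    ∑ i ∈ univ.filter (fun i => 0 < ν i), ν i = -ν b := by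
  simpa [sum_erase_of_mem_Nbeta hν] using sum_filter_pos_of_mem_Nbeta hν 1

end Nbeta

section Epigraph

variable {n m : ℕ} {X : Set (Fin n → ℝ)} {A : Fin m → Fin n → ℝ} {b : Fin m}
  {p q : (Fin m → ℝ) × ℝ}

theorem add_mem_sigmaEpigraph (hp : p ∈ sigmaEpigraph X A b) (hq : q ∈ sigmaEpigraph X A b) :
    p + q ∈ sigmaEpigraph X A b := by
  refine ⟨add_mem_Nbeta hp.1 hq.1, fun x hx => ?_⟩
  have h1 := hp.2 x hx
  have h2 := hq.2 x hx
  simp only [Prod.fst_add, Prod.snd_add, Pi.add_apply, add_mul, Finset.sum_add_distrib]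
  linarith

theorem smul_mem_sigmaEpigraph (hp : p ∈ sigmaEpigraph X A b) {a : ℝ} (ha : 0 ≤ a) :
    a • p ∈ sigmaEpigraph X A b := by
  refine ⟨smul_mem_Nbeta hp.1 ha, fun x hx => ?_⟩
  have h1 := mul_le_mul_of_nonneg_left (hp.2 x hx) ha
  simp only [Prod.smul_fst, Prod.smul_snd, Pi.smul_apply, smul_eq_mul, mul_assoc,
    ← Finset.mul_sum]
  linarith

theorem convex_sigmaEpigraph : Convex ℝ (sigmaEpigraph X A b) :=
  fun _ hp _ hq _ _ ha hb _ => add_mem_sigmaEpigraph (smul_mem_sigmaEpigraph hp ha)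
    (smul_mem_sigmaEpigraph hq hb)

theorem isClosed_sigmaEpigraph : IsClosed (sigmaEpigraph X A b) := by
  have h : sigmaEpigraph X A b = {p | ∀ i, i ≠ b → 0 ≤ p.1 i} ∩ {p | ∑ i, p.1 i = 0} ∩
      {p | ∀ x ∈ X, -∑ i, p.1 i * dotp (A i) x ≤ p.2} := by
    ext p
    simp only [sigmaEpigraph, Nbeta, Set.mem_ofPred_eq, Set.mem_inter_iff]
  rw [h]
  refine (IsClosed.inter ?_ ?_).inter ?_
  · simp only [Set.ofPred_forall]
    exact isClosed_iInter fun i => isClosed_iInter fun _ =>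
      isClosed_le (by fun_prop) (by fun_prop)
  · exact isClosed_eq (by fun_prop) (by fun_prop)
  · simp only [Set.ofPred_forall]
    exact isClosed_iInter fun x => isClosed_iInter fun _ =>
      isClosed_le (by fun_prop) (by fun_prop)

/-- A linear functional which, for `x₀ ∈ X`, is positive on the nonzero part of the epigraph. -/
noncomputable def epiHeight {n m : ℕ} (A : Fin m → Fin n → ℝ) (b : Fin m) (x₀ : Fin n → ℝ) :
    ((Fin m → ℝ) × ℝ) →ₗ[ℝ] ℝ where
  toFun p := -p.1 b + (p.2 + ∑ i, p.1 i * dotp (A i) x₀)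
  map_add' p q := by
    simp only [Prod.fst_add, Prod.snd_add, Pi.add_apply, add_mul, Finset.sum_add_distrib]
    ring
  map_smul' a p := by
    simp only [Prod.smul_fst, Prod.smul_snd, Pi.smul_apply, smul_eq_mul, mul_assoc,
      ← Finset.mul_sum, RingHom.id_apply]
    ring

theorem epiHeight_apply (x₀ : Fin n → ℝ) (p : (Fin m → ℝ) × ℝ) :
    epiHeight A b x₀ p = -p.1 b + (p.2 + ∑ i, p.1 i * dotp (A i) x₀) := rfl

theorem epiHeight_pos (hp : p ∈ sigmaEpigraph X A b) (h0 : p ≠ 0)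
    {x₀ : Fin n → ℝ} (hx₀ : x₀ ∈ X) : 0 < epiHeight A b x₀ p := by
  have h1 := nonpos_of_mem_Nbeta hp.1
  have h2 := hp.2 x₀ hx₀
  rw [epiHeight_apply]
  by_contra! h
  have hb : p.1 = 0 := eq_zero_of_mem_Nbeta hp.1 (by linarith)
  refine h0 (Prod.ext hb ?_)
  simp only [hb, Pi.zero_apply, zero_mul, Finset.sum_const_zero] at h h2
  simp only [Prod.snd_zero]
  linarith

theorem isCompact_sigmaEpigraph_base {x₀ : Fin n → ℝ} (hx₀ : x₀ ∈ X) :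
    IsCompact {p ∈ sigmaEpigraph X A b | epiHeight A b x₀ p = 1} := by
  refine Metric.isCompact_of_isClosed_isBounded ?_ ?_
  · exact isClosed_sigmaEpigraph.inter
      (isClosed_eq (epiHeight A b x₀).continuous_of_finiteDimensional continuous_const)
  · refine isBounded_iff_forall_norm_le.2 ⟨1 + ∑ i, |dotp (A i) x₀|, fun p hp => ?_⟩
    obtain ⟨hp, h1⟩ := hp
    rw [epiHeight_apply] at h1
    have hb := nonpos_of_mem_Nbeta hp.1
    have h2 := hp.2 x₀ hx₀
    have hS : 0 ≤ ∑ i, |dotp (A i) x₀| := Finset.sum_nonneg fun i _ => abs_nonneg _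
    have hle : ∀ i, |p.1 i| ≤ 1 := fun i => by
      by_cases hi : i = b
      · subst hi
        rw [abs_le]; constructor <;> linarith
      · have := le_neg_of_mem_Nbeta hp.1 hi
        have := hp.1.1 i hi
        rw [abs_le]; constructor <;> linarith
    have hsum : |∑ i, p.1 i * dotp (A i) x₀| ≤ ∑ i, |dotp (A i) x₀| := by
      refine (Finset.abs_sum_le_sum_abs _ _).trans (Finset.sum_le_sum fun i _ => ?_)
      rw [abs_mul]
      exact mul_le_of_le_one_left (abs_nonneg _) (hle i)
    rw [abs_le] at hsum
    refine max_le ?_ ?_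
    · refine (pi_norm_le_iff_of_nonneg (by linarith)).2 fun i => ?_
      rw [Real.norm_eq_abs]
      linarith [hle i]
    · rw [Real.norm_eq_abs, abs_le]
      constructor <;> linarith

theorem proportional_of_add_mem_extremePoints {x₀ : Fin n → ℝ} (hx₀ : x₀ ∈ X)
    (hp : p ∈ sigmaEpigraph X A b) (hq : q ∈ sigmaEpigraph X A b) (hp0 : p ≠ 0) (hq0 : q ≠ 0)
    (h : p + q ∈ {p ∈ sigmaEpigraph X A b | epiHeight A b x₀ p = 1}.extremePoints ℝ) :
    ∃ s : ℝ, p = s • (p + q) := by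
  have hpp := epiHeight_pos hp hp0 hx₀
  have hqq := epiHeight_pos hq hq0 hx₀
  have hpq := h.1.2
  rw [map_add] at hpq
  have hnorm : ∀ r ∈ sigmaEpigraph X A b, 0 < epiHeight A b x₀ r →
      (epiHeight A b x₀ r)⁻¹ • r ∈ {p ∈ sigmaEpigraph X A b | epiHeight A b x₀ p = 1} :=
    fun r hr hr0 => ⟨smul_mem_sigmaEpigraph hr (inv_nonneg.2 hr0.le), by
      rw [map_smul, smul_eq_mul, inv_mul_cancel₀ hr0.ne']⟩
  have := h.2 (hnorm p hp hpp) (hnorm q hq hqq)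
    ⟨_, _, hpp, hqq, hpq, by rw [smul_inv_smul₀ hpp.ne', smul_inv_smul₀ hqq.ne']⟩
  exact ⟨epiHeight A b x₀ p, by rw [← this, smul_inv_smul₀ hpp.ne']⟩

theorem normalized_mem_LambdaB_of_mem_extremePoints {x₀ : Fin n → ℝ} (hx₀ : x₀ ∈ X)
    (h : p ∈ {p ∈ sigmaEpigraph X A b | epiHeight A b x₀ p = 1}.extremePoints ℝ)
    (hp0 : p.1 ≠ 0) : (-p.1 b)⁻¹ • p.1 ∈ LambdaB X A b := by
  have hp := h.1.1
  have hXne : X.Nonempty := ⟨x₀, hx₀⟩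
  have hs : 0 < -p.1 b :=
    neg_pos.2 (lt_of_le_of_ne (nonpos_of_mem_Nbeta hp.1) fun hb =>
      hp0 (eq_zero_of_mem_Nbeta hp.1 hb))
  set s := -p.1 b with hsdef
  have hs' : 0 < s⁻¹ := inv_pos.2 hs
  have hscaled := smul_mem_sigmaEpigraph hp hs'.le
  set l := s⁻¹ • p.1 with hl
  have hpl : p.1 = s • l := by rw [hl, smul_inv_smul₀ hs.ne']
  have hlb : l b = -1 := by
    have : p.1 b = -s := by rw [hsdef, neg_neg]
    rw [hl, Pi.smul_apply, this, smul_eq_mul, mul_neg, inv_mul_cancel₀ hs.ne']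
  have hσl : sigA X A l ≤ ((s⁻¹ * p.2 : ℝ) : EReal) := sigA_le_coe_iff.2 hscaled.2
  refine ⟨⟨hscaled.1, fun h0 => by simp [h0] at hlb, hσl.trans_lt (EReal.coe_lt_top _), ?_⟩, hlb⟩
  rintro ⟨ν₁, ν₂, θ, h1, h2, hprop, ⟨hθ0, hθ1⟩, hcomb, haff⟩
  have hθ1' : 0 < 1 - θ := sub_pos.2 hθ1
  have heq := haff θ ⟨hθ0.le, hθ1.le⟩
  rw [← hcomb] at heq
  have hlt : sigA X A l < ⊤ := hσl.trans_lt (EReal.coe_lt_top _)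
  have hb1 := sigA_ne_bot hXne A ν₁
  have hb2 := sigA_ne_bot hXne A ν₂
  obtain ⟨s₁, s₂, hs₁, hs₂⟩ : ∃ s₁ s₂ : ℝ, sigA X A ν₁ = s₁ ∧ sigA X A ν₂ = s₂ := by
    rw [heq] at hlt
    generalize sigA X A ν₁ = u at *
    generalize sigA X A ν₂ = v at *
    induction u with
    | bot => exact absurd rfl hb1
    | top =>
      rw [EReal.coe_mul_top_of_pos hθ0] at hlt
      induction v with
      | bot => exact absurd rfl hb2
      | top => rw [EReal.coe_mul_top_of_pos hθ1'] at hlt; exact absurd hlt (by simp)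
      | coe v =>
        rw [← EReal.coe_mul, EReal.top_add_coe] at hlt
        exact absurd hlt (lt_irrefl _)
    | coe u =>
      induction v with
      | bot => exact absurd rfl hb2
      | top =>
        rw [EReal.coe_mul_top_of_pos hθ1', ← EReal.coe_mul, EReal.coe_add_top] at hlt
        exact absurd hlt (lt_irrefl _)
      | coe v => exact ⟨u, v, rfl, rfl⟩
  rw [heq, hs₁, hs₂, ← EReal.coe_mul, ← EReal.coe_mul, ← EReal.coe_add,
    EReal.coe_le_coe_iff] at hσl
  set δ := s⁻¹ * p.2 - (θ * s₁ + (1 - θ) * s₂) with hδ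
  have hδ0 : 0 ≤ δ := sub_nonneg.2 hσl
  have hm1 : ((ν₁, s₁ + δ) : (Fin m → ℝ) × ℝ) ∈ sigmaEpigraph X A b :=
    ⟨h1, fun x hx => (sigA_le_coe_iff.1 hs₁.le x hx).trans (by linarith)⟩
  have hm2 : ((ν₂, s₂ + δ) : (Fin m → ℝ) × ℝ) ∈ sigmaEpigraph X A b :=
    ⟨h2, fun x hx => (sigA_le_coe_iff.1 hs₂.le x hx).trans (by linarith)⟩
  have hν1 : ν₁ ≠ 0 := fun h0 => hprop ⟨0, Or.inl (by rw [h0, zero_smul])⟩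
  have hν2 : ν₂ ≠ 0 := fun h0 => hprop ⟨0, Or.inr (by rw [h0, zero_smul])⟩
  have ha1 : 0 < s * θ := mul_pos hs hθ0
  have ha2 : 0 < s * (1 - θ) := mul_pos hs hθ1'
  have hsum : (s * θ) • ((ν₁, s₁ + δ) : (Fin m → ℝ) × ℝ) + (s * (1 - θ)) • (ν₂, s₂ + δ) = p := by
    refine Prod.ext ?_ ?_
    · simp only [Prod.fst_add, Prod.smul_fst]
      rw [hpl, hcomb, smul_add, smul_smul, smul_smul]
    · simp only [Prod.snd_add, Prod.smul_snd, smul_eq_mul]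
      rw [hδ]
      field_simp
      ring
  have hne1 : (s * θ) • ((ν₁, s₁ + δ) : (Fin m → ℝ) × ℝ) ≠ 0 := fun h0 =>
    hν1 (congrArg Prod.fst ((smul_eq_zero_iff_right ha1.ne').1 h0))
  have hne2 : (s * (1 - θ)) • ((ν₂, s₂ + δ) : (Fin m → ℝ) × ℝ) ≠ 0 := fun h0 =>
    hν2 (congrArg Prod.fst ((smul_eq_zero_iff_right ha2.ne').1 h0))
  obtain ⟨r, hr⟩ := proportional_of_add_mem_extremePoints hx₀
    (smul_mem_sigmaEpigraph hm1 ha1.le) (smul_mem_sigmaEpigraph hm2 ha2.le) hne1 hne2 (hsum ▸ h)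
  have hr1 : (s * θ) • ν₁ = r • ((s * θ) • ν₁ + (s * (1 - θ)) • ν₂) := congrArg Prod.fst hr
  have hrr : ((1 - r) * (s * θ)) • ν₁ = (r * (s * (1 - θ))) • ν₂ := by
    rw [smul_add, smul_smul, smul_smul] at hr1
    rw [sub_mul, one_mul, sub_smul, hr1]
    abel
  by_cases hr1 : r = 1
  · rw [hr1, sub_self, zero_mul, zero_smul, one_mul] at hrr
    exact hν2 ((smul_eq_zero_iff_right ha2.ne').1 hrr.symm)
  · have hc : (1 - r) * (s * θ) ≠ 0 := mul_ne_zero (sub_ne_zero.2 (Ne.symm hr1)) ha1.ne'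
    refine hprop ⟨((1 - r) * (s * θ))⁻¹ * (r * (s * (1 - θ))), Or.inl ?_⟩
    rw [mul_smul, ← hrr, inv_smul_smul₀ hc]

end Epigraph

section WitnessCone

variable {n m : ℕ} {X : Set (Fin n → ℝ)} {A : Fin m → Fin n → ℝ} {b : Fin m} {l : Fin m → ℝ}

theorem sum_filter_pos_eq_one_of_mem_LambdaB (hl : l ∈ LambdaB X A b) :
    ∑ i ∈ univ.filter (fun i => 0 < l i), l i = 1 := by
  rw [sum_filter_pos_one_of_mem_Nbeta hl.1.1, hl.2, neg_neg]

theorem ne_of_pos_of_mem_LambdaB (hl : l ∈ LambdaB X A b) {i : Fin m} (hi : 0 < l i) :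
    i ≠ b := by
  rintro rfl
  exact absurd hi (not_lt.2 (nonpos_of_mem_Nbeta hl.1.1))

theorem witnessProd_nonneg (hl : l ∈ LambdaB X A b) {c : Fin m → ℝ}
    (hc : ∀ i, i ≠ b → 0 ≤ c i) :
    0 ≤ ∏ i ∈ univ.filter (fun i => 0 < l i), (c i / l i) ^ (l i) :=
  Finset.prod_nonneg fun i hi => by
    have hi := (Finset.mem_filter.1 hi).2
    exact Real.rpow_nonneg (div_nonneg (hc i (ne_of_pos_of_mem_LambdaB hl hi)) hi.le) _

theorem mem_witnessCone_of_nonneg (hl : l ∈ LambdaB X A b) {c : Fin m → ℝ} (hc : 0 ≤ c) :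
    c ∈ WitnessCone X A b l :=
  ⟨fun i _ => hc i, (mul_nonpos_of_nonpos_of_nonneg (neg_nonpos.2 (hc b))
    (Real.exp_pos _).le).trans (witnessProd_nonneg hl fun i _ => hc i)⟩

theorem smul_mem_witnessCone (hl : l ∈ LambdaB X A b) {c : Fin m → ℝ}
    (hc : c ∈ WitnessCone X A b l) {a : ℝ} (ha : 0 < a) : a • c ∈ WitnessCone X A b l := by
  refine ⟨fun i hi => mul_nonneg ha.le (hc.1 i hi), ?_⟩
  have h : ∏ i ∈ univ.filter (fun i => 0 < l i), ((a • c) i / l i) ^ (l i) =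
      a * ∏ i ∈ univ.filter (fun i => 0 < l i), (c i / l i) ^ (l i) := by
    have h1 : ∏ i ∈ univ.filter (fun i => 0 < l i), a ^ (l i) = a := by
      rw [← Real.rpow_sum_of_pos ha, sum_filter_pos_eq_one_of_mem_LambdaB hl, Real.rpow_one]
    nth_rewrite 2 [← h1]
    rw [← Finset.prod_mul_distrib]
    refine Finset.prod_congr rfl fun i hi => ?_
    have hi := (Finset.mem_filter.1 hi).2
    rw [Pi.smul_apply, smul_eq_mul, mul_div_assoc, Real.mul_rpow ha.le
      (div_nonneg (hc.1 i (ne_of_pos_of_mem_LambdaB hl hi)) hi.le)]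
  rw [h, Pi.smul_apply, smul_eq_mul]
  have := mul_le_mul_of_nonneg_left hc.2 ha.le
  linarith

theorem sigA_toReal_le (hX : X.Nonempty) {τ : ℝ}
    (h : ∀ x ∈ X, -∑ i, l i * dotp (A i) x ≤ τ) : (sigA X A l).toReal ≤ τ :=
  EReal.toReal_le_toReal (sigA_le_coe_iff.2 h) (sigA_ne_bot hX A l) (EReal.coe_ne_top τ)

theorem le_sigA_toReal (hl : sigA X A l < ⊤) {x : Fin n → ℝ} (hx : x ∈ X) :
    -∑ i, l i * dotp (A i) x ≤ (sigA X A l).toReal := by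
  have h : sigA X A l = ((sigA X A l).toReal : EReal) :=
    (EReal.coe_toReal hl.ne (sigA_ne_bot ⟨x, hx⟩ A l)).symm
  exact sigA_le_coe_iff.1 h.le x hx

theorem witnessCone_subset_ageCone (hl : l ∈ LambdaB X A b) :
    WitnessCone X A b l ⊆ AgeCone X A b := by
  rintro c ⟨hc, hprod⟩
  refine ⟨hc, fun x hx => ?_⟩
  set S := univ.filter (fun i => 0 < l i) with hS
  have hpos : ∀ i ∈ S, 0 < l i := fun i hi => (Finset.mem_filter.1 hi).2
  have hcS : ∀ i ∈ S, 0 ≤ c i / l i := fun i hi =>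
    div_nonneg (hc i (ne_of_pos_of_mem_LambdaB hl (hpos i hi))) (hpos i hi).le
  have hamgm := Real.geom_mean_le_arith_mean_weighted S l
    (fun i => c i / l i * Real.exp (dotp (A i) x)) (fun i hi => (hpos i hi).le)
    (sum_filter_pos_eq_one_of_mem_LambdaB hl)
    (fun i hi => mul_nonneg (hcS i hi) (Real.exp_pos _).le)
  have hsplit : ∏ i ∈ S, (c i / l i * Real.exp (dotp (A i) x)) ^ l i =
      (∏ i ∈ S, (c i / l i) ^ l i) * Real.exp (∑ i ∈ S, l i * dotp (A i) x) := by
    rw [Real.exp_sum, ← Finset.prod_mul_distrib]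
    refine Finset.prod_congr rfl fun i hi => ?_
    rw [Real.mul_rpow (hcS i hi) (Real.exp_pos _).le, ← Real.exp_mul, mul_comm (l i)]
  have hle : ∑ i ∈ S, l i * (c i / l i * Real.exp (dotp (A i) x)) ≤
      ∑ i ∈ univ.erase b, c i * Real.exp (dotp (A i) x) := by
    rw [Finset.sum_congr rfl (g := fun i => c i * Real.exp (dotp (A i) x)) fun i hi => by
      have := (hpos i hi).ne'
      field_simp]
    refine Finset.sum_le_sum_of_subset_of_nonneg (fun i hi => ?_) fun i hi _ =>
      mul_nonneg (hc i (Finset.ne_of_mem_erase hi)) (Real.exp_pos _).le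
    exact Finset.mem_erase.2 ⟨ne_of_pos_of_mem_LambdaB hl (hpos i hi), mem_univ i⟩
  have hsum := sum_filter_pos_of_mem_Nbeta hl.1.1 (fun i => dotp (A i) x)
  have hσ := le_sigA_toReal hl.1.2.2.1 hx
  rw [← Finset.add_sum_erase univ _ (mem_univ b), hl.2, ← hsum] at hσ
  rw [hsplit] at hamgm
  rw [← Finset.add_sum_erase univ _ (mem_univ b)]
  have hexp : Real.exp (dotp (A b) x) * Real.exp (-(sigA X A l).toReal) ≤
      Real.exp (∑ i ∈ S, l i * dotp (A i) x) := by
    rw [← Real.exp_add]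
    exact Real.exp_le_exp.2 (by linarith)
  have h1 := mul_le_mul_of_nonneg_left hexp (witnessProd_nonneg hl hc)
  have h2 := mul_le_mul_of_nonneg_right hprod
    (mul_pos (Real.exp_pos (dotp (A b) x)) (Real.exp_pos (-(sigA X A l).toReal))).le
  have h3 : -c b * Real.exp (sigA X A l).toReal *
      (Real.exp (dotp (A b) x) * Real.exp (-(sigA X A l).toReal)) =
        -(c b * Real.exp (dotp (A b) x)) := by
    rw [Real.exp_neg]
    field_simp
  rw [h3] at h2
  linarith

theorem convex_ageCone : Convex ℝ (AgeCone X A b) := by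
  intro c hc d hd s t hs ht _
  refine ⟨fun i hi => add_nonneg (mul_nonneg hs (hc.1 i hi)) (mul_nonneg ht (hd.1 i hi)),
    fun x hx => ?_⟩
  have h1 := mul_nonneg hs (hc.2 x hx)
  have h2 := mul_nonneg ht (hd.2 x hx)
  simp only [Pi.add_apply, Pi.smul_apply, smul_eq_mul, add_mul, Finset.sum_add_distrib, mul_assoc,
    ← Finset.mul_sum]
  exact add_nonneg h1 h2

/-- Redistribution of the coefficient vector `c` along the epigraph of the support function. It
sends the pair `(ν, τ)` to the coefficient vector whose entries away from `b` are those of `c`, and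
whose entry at `b` is the value of the relative entropy bound at `(ν, τ)`. -/
noncomputable def splitMap {m : ℕ} (b : Fin m) (c ν : Fin m → ℝ) :
    ((Fin m → ℝ) × ℝ) →ₗ[ℝ] (Fin m → ℝ) where
  toFun p i := if i = b then p.2 + ∑ j ∈ univ.erase b, p.1 j * (Real.log (ν j / c j) - 1)
    else p.1 i * (c i / ν i)
  map_add' p q := by
    ext i
    simp only [Prod.fst_add, Prod.snd_add, Pi.add_apply, add_mul, Finset.sum_add_distrib]
    split_ifs <;> ring
  map_smul' a p := by
    ext i
    simp only [Prod.smul_fst, Prod.smul_snd, Pi.smul_apply, smul_eq_mul, mul_assoc,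
      ← Finset.mul_sum, RingHom.id_apply]
    split_ifs <;> ring

theorem splitMap_apply_self (c ν : Fin m → ℝ) (p : (Fin m → ℝ) × ℝ) :
    splitMap b c ν p b = p.2 + ∑ j ∈ univ.erase b, p.1 j * (Real.log (ν j / c j) - 1) :=
  if_pos rfl

theorem splitMap_apply_of_ne (c ν : Fin m → ℝ) (p : (Fin m → ℝ) × ℝ) {i : Fin m} (hi : i ≠ b) :
    splitMap b c ν p i = p.1 i * (c i / ν i) :=
  if_neg hi

theorem splitMap_mem_witnessCone (hX : X.Nonempty) {c ν : Fin m → ℝ}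
    (hc : ∀ i, i ≠ b → 0 ≤ c i) (hν : ∀ i, i ≠ b → 0 ≤ ν i) {p : (Fin m → ℝ) × ℝ}
    (hp : p ∈ sigmaEpigraph X A b) (hpc : ∀ i, i ≠ b → 0 < p.1 i → 0 < ν i ∧ 0 < c i)
    (hl : (-p.1 b)⁻¹ • p.1 ∈ LambdaB X A b) :
    splitMap b c ν p ∈ WitnessCone X A b ((-p.1 b)⁻¹ • p.1) := by
  have hs : 0 < -p.1 b := by
    refine neg_pos.2 (lt_of_le_of_ne (nonpos_of_mem_Nbeta hp.1) fun h => ?_)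
    have := hl.2
    simp [h] at this
  set s := -p.1 b
  have hsc := (smul_mem_sigmaEpigraph hp (inv_pos.2 hs).le).2
  simp only [Prod.smul_fst, Prod.smul_snd, smul_eq_mul] at hsc
  have hσ := sigA_toReal_le hX hsc
  set l := s⁻¹ • p.1 with hldef
  have hpl : p.1 = s • l := by rw [hldef, smul_inv_smul₀ hs.ne']
  refine ⟨fun i hi => ?_, ?_⟩
  · rw [splitMap_apply_of_ne _ _ _ hi]
    exact mul_nonneg (hp.1.1 i hi) (div_nonneg (hc i hi) (hν i hi))
  set S := univ.filter (fun i => 0 < l i) with hS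
  have hpos : ∀ i ∈ S, 0 < l i := fun i hi => (Finset.mem_filter.1 hi).2
  have hone : ∑ i ∈ S, l i = 1 := sum_filter_pos_eq_one_of_mem_LambdaB hl
  set L := ∑ i ∈ S, l i * Real.log (c i / ν i) with hL
  have hprod : ∏ i ∈ S, (splitMap b c ν p i / l i) ^ l i = s * Real.exp L := by
    have h1 : ∀ i ∈ S, (splitMap b c ν p i / l i) ^ l i =
        Real.exp (l i * Real.log s + l i * Real.log (c i / ν i)) := fun i hi => by
      have hib := ne_of_pos_of_mem_LambdaB hl (hpos i hi)
      have hpi : 0 < p.1 i := by rw [hpl]; exact mul_pos hs (hpos i hi)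
      obtain ⟨hνi, hci⟩ := hpc i hib hpi
      have hdiv : splitMap b c ν p i / l i = s * (c i / ν i) := by
        rw [splitMap_apply_of_ne _ _ _ hib, hpl, Pi.smul_apply, smul_eq_mul]
        have := (hpos i hi).ne'
        field_simp
      have hq : 0 < c i / ν i := div_pos hci hνi
      rw [hdiv, Real.rpow_def_of_pos (mul_pos hs hq), Real.log_mul hs.ne' hq.ne']
      ring_nf
    rw [Finset.prod_congr rfl h1, ← Real.exp_sum, Finset.sum_add_distrib, ← Finset.sum_mul, hone,
      one_mul, Real.exp_add, Real.exp_log hs]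
  have hb : splitMap b c ν p b = p.2 - s * L - s := by
    rw [splitMap_apply_self, hpl]
    simp only [Pi.smul_apply, smul_eq_mul, mul_assoc, ← Finset.mul_sum]
    rw [← sum_filter_pos_of_mem_Nbeta hl.1.1 (fun j => Real.log (ν j / c j) - 1)]
    have h2 : ∑ i ∈ S, l i * (Real.log (ν i / c i) - 1) = -L - 1 := by
      rw [Finset.sum_congr rfl (g := fun i => -(l i * Real.log (c i / ν i)) - l i) fun i _ => by
        rw [← inv_div (c i) (ν i), Real.log_inv]
        ring, Finset.sum_sub_distrib, Finset.sum_neg_distrib, hone]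
    rw [h2]
    ring
  rw [hprod, hb]
  generalize (sigA X A l).toReal = σ at *
  have hσ' : s * σ ≤ p.2 := by
    have := mul_le_mul_of_nonneg_left hσ hs.le
    rwa [mul_inv_cancel_left₀ hs.ne'] at this
  have hexp : L - σ + 1 ≤ Real.exp (L - σ) := Real.add_one_le_exp _
  calc -(p.2 - s * L - s) * Real.exp σ ≤ (s * Real.exp (L - σ)) * Real.exp σ := by
        refine mul_le_mul_of_nonneg_right ?_ (Real.exp_pos σ).le
        have := mul_le_mul_of_nonneg_left hexp hs.le
        linarith
    _ = s * Real.exp L := by rw [mul_assoc, ← Real.exp_add, sub_add_cancel]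

end WitnessCone

theorem exists_separation_of_mem_ageCone {n m : ℕ} {X : Set (Fin n → ℝ)} (hXne : X.Nonempty)
    (hXcv : Convex ℝ X) {A : Fin m → Fin n → ℝ} {b : Fin m} {c : Fin m → ℝ}
    (hc : c ∈ AgeCone X A b) :
    ∃ (ν : Fin m → ℝ) (r : ℝ),
      (∀ u : Fin m → ℝ, ∑ i, u i * ν i - ∑ i ∈ univ.erase b, c i * Real.exp (u i) ≤ r) ∧
      ∀ x ∈ X, r ≤ ∑ i, (dotp (A i) x - dotp (A b) x) * ν i + c b := by
  let F : (Fin m → ℝ) → ℝ := fun u => ∑ i ∈ univ.erase b, c i * Real.exp (u i)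
  let U : (Fin n → ℝ) → Fin m → ℝ := fun x i => dotp (A i) x - dotp (A b) x
  have hF : ConvexOn ℝ Set.univ F := by
    refine ⟨convex_univ, fun u _ v _ s t hs ht hst => ?_⟩
    simp only [F, smul_eq_mul, Finset.mul_sum, ← Finset.sum_add_distrib]
    refine Finset.sum_le_sum fun i hi => ?_
    have h1 := convexOn_exp.2 (Set.mem_univ (u i)) (Set.mem_univ (v i)) hs ht hst
    simp only [smul_eq_mul] at h1
    have h2 := mul_le_mul_of_nonneg_left h1 (hc.1 i (Finset.ne_of_mem_erase hi))
    simp only [Pi.add_apply, Pi.smul_apply, smul_eq_mul]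
    linarith
  have hdot : ∀ (a : Fin n → ℝ) (x y : Fin n → ℝ) (s t : ℝ),
      dotp a (s • x + t • y) = s * dotp a x + t * dotp a y := fun a x y s t => by
    simp only [dotp, Finset.mul_sum, ← Finset.sum_add_distrib, Pi.add_apply, Pi.smul_apply,
      smul_eq_mul]
    exact Finset.sum_congr rfl fun i _ => by ring
  let S : Set ((Fin m → ℝ) × ℝ) := {p | F p.1 < p.2}
  let T : Set ((Fin m → ℝ) × ℝ) := {p | ∃ x ∈ X, p.1 = U x ∧ p.2 ≤ -c b}
  have hS : Convex ℝ S := by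
    have := hF.convex_strict_epigraph
    simpa only [Set.mem_univ, true_and] using this
  have hSo : IsOpen S := isOpen_lt (by fun_prop) (by fun_prop)
  have hT : Convex ℝ T := by
    rintro p ⟨x, hx, hp1, hp2⟩ q ⟨y, hy, hq1, hq2⟩ s t hs ht hst
    refine ⟨s • x + t • y, hXcv hx hy hs ht hst, ?_, ?_⟩
    · ext i
      simp only [Prod.fst_add, Prod.smul_fst, hp1, hq1, U, hdot, Pi.add_apply, Pi.smul_apply,
        smul_eq_mul]
      ring
    · simp only [Prod.snd_add, Prod.smul_snd, smul_eq_mul]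
      have h1 := mul_le_mul_of_nonneg_left hp2 hs
      have h2 := mul_le_mul_of_nonneg_left hq2 ht
      have h3 : -c b = s * -c b + t * -c b := by rw [← add_mul, hst, one_mul]
      linarith
  have hlow : ∀ x ∈ X, -c b ≤ F (U x) := fun x hx => by
    have h1 := hc.2 x hx
    rw [← Finset.add_sum_erase univ _ (mem_univ b)] at h1
    have h2 : F (U x) * Real.exp (dotp (A b) x) =
        ∑ i ∈ univ.erase b, c i * Real.exp (dotp (A i) x) := by
      simp only [F, U, Finset.sum_mul, mul_assoc, ← Real.exp_add, sub_add_cancel]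
    rw [← h2, ← add_mul] at h1
    have h3 := nonneg_of_mul_nonneg_left h1 (Real.exp_pos _)
    linarith
  have hdisj : Disjoint S T := Set.disjoint_left.2 fun p hpS hpT => by
    obtain ⟨x, hx, hp1, hp2⟩ := hpT
    have h1 : F p.1 < p.2 := hpS
    rw [hp1] at h1
    linarith [hlow x hx]
  obtain ⟨f, r, hfS, hfT⟩ := geometric_hahn_banach_open hS hSo hT hdisj
  obtain ⟨g, ω, hf⟩ : ∃ (g : Fin m → ℝ) (ω : ℝ), ∀ u t, f (u, t) = ∑ i, u i * g i + t * ω := by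
    refine ⟨fun i => f (Pi.single i 1, 0), f (0, 1), fun u t => ?_⟩
    have h1 : f (u, t) = (f.toLinearMap ∘ₗ LinearMap.inl ℝ (Fin m → ℝ) ℝ) u + f (0, t) := by
      simp [← map_add]
    have h2 : f (0, t) = t * f (0, 1) := by
      rw [← smul_eq_mul, ← map_smul]
      simp
    rw [h1, h2, LinearMap.pi_apply_eq_sum_univ]
    congr 1
    refine Finset.sum_congr rfl fun i _ => ?_
    rw [smul_eq_mul]
    have h3 : (fun j => if i = j then (1 : ℝ) else 0) = Pi.single i 1 := by
      ext j
      simp [Pi.single_apply, eq_comm]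
    rw [h3]
    rfl
  have hω : ω < 0 := by
    obtain ⟨x, hx⟩ := hXne
    have h1 := hfS (U x, F (U x) + 1) (show F (U x) < F (U x) + 1 by linarith)
    have h2 := hfT (U x, -c b) ⟨x, hx, rfl, le_rfl⟩
    rw [hf] at h1 h2
    have h3 := hlow x hx
    by_contra! h
    nlinarith
  have hω' : 0 < (-ω)⁻¹ := inv_pos.2 (neg_pos.2 hω)
  have hinv : (-ω)⁻¹ * ω = -1 := by
    have := hω.ne
    field_simp
  have hscale : ∀ (u : Fin m → ℝ) (t : ℝ),
      (-ω)⁻¹ * (∑ i, u i * g i + t * ω) = ∑ i, u i * ((-ω)⁻¹ * g i) - t := fun u t => by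
    rw [mul_add, mul_left_comm, hinv, Finset.mul_sum]
    simp only [mul_left_comm (-ω)⁻¹]
    ring
  refine ⟨fun i => (-ω)⁻¹ * g i, (-ω)⁻¹ * r, fun u => ?_, fun x hx => ?_⟩
  · refine le_of_forall_pos_le_add fun ε hε => ?_
    have h1 := hfS (u, F u + ε) (show F u < F u + ε by linarith)
    rw [hf] at h1
    have h2 := mul_le_mul_of_nonneg_left h1.le hω'.le
    rw [hscale] at h2
    simp only [F] at h2
    linarith
  · have h1 := hfT (U x, -c b) ⟨x, hx, rfl, le_rfl⟩
    rw [hf] at h1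
    have h2 := mul_le_mul_of_nonneg_left h1 hω'.le
    rw [hscale] at h2
    simp only [U] at h2
    linarith

theorem nonneg_of_forall_nonpos_mul_le {a M : ℝ} (h : ∀ y ≤ 0, y * a ≤ M) : 0 ≤ a := by
  by_contra! ha
  have hM : 0 ≤ M := by simpa using h 0 le_rfl
  have h1 := h ((M + 1) / a) (div_nonpos_of_nonneg_of_nonpos (by linarith) ha.le)
  rw [div_mul_cancel₀ _ ha.ne] at h1
  linarith

theorem eq_zero_of_forall_mul_le {a M : ℝ} (h : ∀ y, y * a ≤ M) : a = 0 := by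
  refine le_antisymm (neg_nonneg.1 (nonneg_of_forall_nonpos_mul_le (M := M) fun y _ => ?_))
    (nonneg_of_forall_nonpos_mul_le fun y _ => h y)
  have := h (-y)
  linarith

/-- Strong duality for the conditional AGE cone: membership is certified by a point of the epigraph
of the support function satisfying a relative entropy inequality. -/
theorem exists_mem_sigmaEpigraph_of_mem_ageCone {n m : ℕ} {X : Set (Fin n → ℝ)}
    (hXne : X.Nonempty) (hXcv : Convex ℝ X) {A : Fin m → Fin n → ℝ} {b : Fin m} {c : Fin m → ℝ}
    (hc : c ∈ AgeCone X A b) :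
    ∃ p ∈ sigmaEpigraph X A b, (∀ i, i ≠ b → c i = 0 → p.1 i = 0) ∧
      p.2 + ∑ i ∈ univ.erase b, p.1 i * (Real.log (p.1 i / c i) - 1) ≤ c b := by
  obtain ⟨ν, r, hr, hX⟩ := exists_separation_of_mem_ageCone hXne hXcv hc
  set C := ∑ i ∈ univ.erase b, c i with hC
  have hsingle : ∀ (i : Fin m) (y : ℝ), (i = b ∨ c i = 0 ∨ y ≤ 0) → y * ν i ≤ r + C := by
    intro i y hiy
    have h1 := hr (Pi.single i y)
    have h2 : ∑ j, (Pi.single i y : Fin m → ℝ) j * ν j = y * ν i := by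
      simp [Pi.single_apply]
    have h3 : ∑ j ∈ univ.erase b, c j * Real.exp ((Pi.single i y : Fin m → ℝ) j) ≤ C := by
      refine Finset.sum_le_sum fun j hj => ?_
      have hjb := Finset.ne_of_mem_erase hj
      by_cases hji : j = i
      · subst hji
        rw [Pi.single_eq_same]
        rcases hiy with h | h | h
        · exact absurd h hjb
        · simp [h]
        · exact mul_le_of_le_one_right (hc.1 j hjb) (Real.exp_le_one_iff.2 h)
      · simp [Pi.single_eq_of_ne hji]
    rw [h2] at h1
    linarith
  have hνb : ν b = 0 := eq_zero_of_forall_mul_le fun y => hsingle b y (Or.inl rfl)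
  have hν0 : ∀ i, c i = 0 → ν i = 0 := fun i hi =>
    eq_zero_of_forall_mul_le fun y => hsingle i y (Or.inr (Or.inl hi))
  have hνnn : ∀ i, 0 ≤ ν i := fun i =>
    nonneg_of_forall_nonpos_mul_le fun y hy => hsingle i y (Or.inr (Or.inr hy))
  have hent : ∑ i ∈ univ.erase b, ν i * (Real.log (ν i / c i) - 1) ≤ r := by
    refine le_of_forall_pos_le_add fun ε hε => ?_
    have hCnn : 0 ≤ C := Finset.sum_nonneg fun i hi => hc.1 i (Finset.ne_of_mem_erase hi)
    set η := ε / (C + 1) with hη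
    have hη0 : 0 < η := div_pos hε (by linarith)
    have hηC : η * C ≤ ε := by
      rw [hη, div_mul_eq_mul_div, div_le_iff₀ (by linarith)]
      nlinarith
    have h1 := hr fun i => if ν i = 0 then Real.log η else Real.log (ν i / c i)
    rw [← Finset.add_sum_erase univ _ (mem_univ b), hνb, mul_zero, zero_add,
      ← Finset.sum_sub_distrib] at h1
    have h2 : ∑ i ∈ univ.erase b, (ν i * (Real.log (ν i / c i) - 1) - η * c i) ≤ r := by
      refine le_trans (Finset.sum_le_sum fun i hi => ?_) h1
      have hci := hc.1 i (Finset.ne_of_mem_erase hi)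
      by_cases h : ν i = 0
      · simp [h, Real.exp_log hη0, mul_comm]
      · have hci' : 0 < c i := lt_of_le_of_ne hci fun h' => h (hν0 i h'.symm)
        have hνi : 0 < ν i := lt_of_le_of_ne (hνnn i) (Ne.symm h)
        simp only [h, if_false]
        rw [Real.exp_log (div_pos hνi hci'), mul_div_cancel₀ _ hci'.ne']
        have := mul_pos hη0 hci'
        linarith
    rw [Finset.sum_sub_distrib, ← Finset.mul_sum] at h2
    linarith
  let μ : Fin m → ℝ := fun i => if i = b then -∑ j, ν j else ν i
  have hμ : ∀ i, i ≠ b → μ i = ν i := fun i hi => if_neg hi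
  have hμb : μ b = -∑ j, ν j := if_pos rfl
  have hνsum : ∑ i ∈ univ.erase b, ν i = ∑ i, ν i := by
    rw [← Finset.add_sum_erase univ ν (mem_univ b), hνb, zero_add]
  have hsum : ∀ f : Fin m → ℝ, ∑ i ∈ univ.erase b, μ i * f i = ∑ i, ν i * f i := fun f => by
    rw [← Finset.add_sum_erase univ (fun i => ν i * f i) (mem_univ b), hνb, zero_mul, zero_add]
    exact Finset.sum_congr rfl fun i hi => by rw [hμ i (Finset.ne_of_mem_erase hi)]
  refine ⟨(μ, c b - r), ⟨⟨fun i hi => ?_, ?_⟩, fun x hx => ?_⟩, fun i hi hci => ?_, ?_⟩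
  · simpa [hμ i hi] using hνnn i
  · have := hsum 1
    simp only [Pi.one_apply, mul_one] at this
    rw [← Finset.add_sum_erase univ _ (mem_univ b)]
    simp only [this, hμb, neg_add_cancel]
  · have h1 := hX x hx
    simp only [sub_mul, Finset.sum_sub_distrib, ← Finset.mul_sum] at h1
    rw [← Finset.add_sum_erase univ _ (mem_univ b)]
    simp only [hsum, hμb]
    simp only [mul_comm (ν _)]
    linarith
  · simp [hμ i hi, hν0 i hci]
  · have h1 : ∑ i ∈ univ.erase b, μ i * (Real.log (μ i / c i) - 1) =
        ∑ i ∈ univ.erase b, ν i * (Real.log (ν i / c i) - 1) :=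
      Finset.sum_congr rfl fun i hi => by rw [hμ i (Finset.ne_of_mem_erase hi)]
    simp only [h1]
    linarith

section ConvexHull

open scoped Pointwise

variable {E : Type*} [AddCommGroup E] [Module ℝ E] {S : Set E}

theorem smul_mem_convexHull_of_forall_smul_mem (hS : ∀ c ∈ S, ∀ a : ℝ, 0 < a → a • c ∈ S)
    {x : E} (hx : x ∈ convexHull ℝ S) {a : ℝ} (ha : 0 < a) : a • x ∈ convexHull ℝ S := by
  have h : a • x ∈ convexHull ℝ (a • S) := by
    rw [convexHull_smul]
    exact Set.smul_mem_smul_set hx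
  refine convexHull_mono ?_ h
  rintro _ ⟨c, hc, rfl⟩
  exact hS c hc a ha

theorem add_mem_convexHull_of_forall_smul_mem (hS : ∀ c ∈ S, ∀ a : ℝ, 0 < a → a • c ∈ S)
    {x y : E} (hx : x ∈ convexHull ℝ S) (hy : y ∈ convexHull ℝ S) :
    x + y ∈ convexHull ℝ S := by
  have h := convex_convexHull ℝ S (smul_mem_convexHull_of_forall_smul_mem hS hx two_pos)
    (smul_mem_convexHull_of_forall_smul_mem hS hy two_pos)
    (show (0 : ℝ) ≤ 1 / 2 by norm_num) (show (0 : ℝ) ≤ 1 / 2 by norm_num) (by norm_num)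
  rw [smul_smul, smul_smul] at h
  norm_num at h
  exact h

end ConvexHull

theorem statement5 {n m : ℕ} (X : Set (Fin n → ℝ)) (hXne : X.Nonempty) (hXcl : IsClosed X)
    (hXcv : Convex ℝ X) (A : Fin m → Fin n → ℝ) (hA : Function.Injective A) (hm : 0 < m)
    (b : Fin m) (hL : (LambdaB X A b).Nonempty) :
    AgeCone X A b = convexHull ℝ (⋃ l ∈ LambdaB X A b, WitnessCone X A b l) := by
  refine Set.Subset.antisymm (fun c hc => ?_) (convexHull_min
    (Set.iUnion₂_subset fun l hl => witnessCone_subset_ageCone hl) convex_ageCone)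
  obtain ⟨l₀, hl₀⟩ := hL
  set S := ⋃ l ∈ LambdaB X A b, WitnessCone X A b l with hSdef
  have hS : ∀ d ∈ S, ∀ a : ℝ, 0 < a → a • d ∈ S := by
    intro d hd a ha
    rw [hSdef, Set.mem_iUnion₂] at hd ⊢
    obtain ⟨l, hl, hdl⟩ := hd
    exact ⟨l, hl, smul_mem_witnessCone hl hdl ha⟩
  have hmem : ∀ l ∈ LambdaB X A b, ∀ d ∈ WitnessCone X A b l, d ∈ convexHull ℝ S :=
    fun l hl d hd => subset_convexHull ℝ S (Set.mem_iUnion₂.2 ⟨l, hl, hd⟩)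
  have hnn : ∀ d : Fin m → ℝ, 0 ≤ d → d ∈ convexHull ℝ S := fun d hd =>
    hmem l₀ hl₀ d (mem_witnessCone_of_nonneg hl₀ hd)
  obtain ⟨p, hp, hp0, hpc⟩ := exists_mem_sigmaEpigraph_of_mem_ageCone hXne hXcv hc
  have hrest : 0 ≤ c - splitMap b c p.1 p := by
    intro i
    rw [Pi.zero_apply, Pi.sub_apply, sub_nonneg]
    by_cases hi : i = b
    · subst hi
      rwa [splitMap_apply_self]
    · rw [splitMap_apply_of_ne _ _ _ hi]
      by_cases h : p.1 i = 0
      · rw [h, zero_mul]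
        exact hc.1 i hi
      · rw [mul_div_cancel₀ _ h]
  suffices h : splitMap b c p.1 p ∈ convexHull ℝ S by
    have := add_mem_convexHull_of_forall_smul_mem hS h (hnn _ hrest)
    rwa [add_sub_cancel] at this
  by_cases hpz : p = 0
  · rw [hpz, map_zero]
    exact hnn 0 le_rfl
  obtain ⟨x₀, hx₀⟩ := hXne
  have hht := epiHeight_pos hp hpz hx₀
  set B := {p ∈ sigmaEpigraph X A b | epiHeight A b x₀ p = 1} with hB
  have hBcv : Convex ℝ B := convex_sigmaEpigraph.inter
    ((convex_singleton (1 : ℝ)).linear_preimage (epiHeight A b x₀))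
  have hqB : (epiHeight A b x₀ p)⁻¹ • p ∈ B :=
    ⟨smul_mem_sigmaEpigraph hp (inv_pos.2 hht).le, by
      rw [map_smul, smul_eq_mul, inv_mul_cancel₀ hht.ne']⟩
  obtain ⟨ι, _, z, w, hz, -, hw, hw1, hwz⟩ := eq_pos_convex_span_of_mem_convexHull
    ((isCompact_sigmaEpigraph_base hx₀).subset_convexHull_extremePoints hBcv hqB)
  have hzB : ∀ j, z j ∈ B.extremePoints ℝ := fun j => hz (Set.mem_range_self j)
  have hsupp : ∀ j i, i ≠ b → 0 < (z j).1 i → 0 < p.1 i := by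
    intro j i hi hji
    have h1 : 0 < ((epiHeight A b x₀ p)⁻¹ • p).1 i := by
      rw [← hwz, Prod.fst_sum, Finset.sum_apply]
      refine Finset.sum_pos' (fun k _ => ?_) ⟨j, Finset.mem_univ j, ?_⟩
      · exact mul_nonneg (hw k).le ((hzB k).1.1.1.1 i hi)
      · exact mul_pos (hw j) hji
    exact pos_of_mul_pos_right h1 (inv_pos.2 hht).le
  have hzmem : ∀ j, splitMap b c p.1 (z j) ∈ convexHull ℝ S := by
    intro j
    have hzK := (hzB j).1.1
    by_cases hj : (z j).1 = 0
    · refine hnn _ fun i => ?_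
      by_cases hi : i = b
      · subst hi
        have := hzK.2 x₀ hx₀
        rw [splitMap_apply_self]
        simpa [hj] using this
      · rw [splitMap_apply_of_ne _ _ _ hi]
        simp [hj]
    · have hl := normalized_mem_LambdaB_of_mem_extremePoints hx₀ (hzB j) hj
      refine hmem _ hl _ (splitMap_mem_witnessCone ⟨x₀, hx₀⟩ hc.1 hp.1.1 hzK ?_ hl)
      intro i hi hji
      have hpi := hsupp j i hi hji
      exact ⟨hpi, lt_of_le_of_ne (hc.1 i hi) fun h => hpi.ne' (hp0 i hi h.symm)⟩
  have hqmem : splitMap b c p.1 ((epiHeight A b x₀ p)⁻¹ • p) ∈ convexHull ℝ S := by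
    rw [← hwz, map_sum]
    simp only [map_smul]
    exact (convex_convexHull ℝ S).sum_mem (fun j _ => (hw j).le) hw1 fun j _ => hzmem j
  have := smul_mem_convexHull_of_forall_smul_mem hS hqmem hht
  rwa [map_smul, smul_inv_smul₀ hht.ne'] at this
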